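/- Let X be a regular curve and f : X → X a homeomorphism. Then the following are equivalent: (1) the map ω_f : X → 2^X, x ↦ ω_f(x), is continuous with respect to the Hausdorff metric; (2) ω_f(x) = α_f(x) for every x ∈ X; (3) the map α_f : X → 2^X, x ↦ α_f(x), is continuous with respect to the Hausdorff metric. -/

import Mathlib

open Set Filter Metric Topology

/-- The defining condition of a regular curve: every point has arbitrarily small
open neighborhoods with finite boundary. (Together with the instance assumptions
`Nonempty`, `CompactSpace`, `ConnectedSpace` on a metric space, this says `X` is a
regular curve.) -/
def regularCurveAx (X : Type*) [MetricSpace X] : Prop :=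
  ∀ (x : X) (V : Set X), IsOpen V → x ∈ V →
    ∃ U : Set X, IsOpen U ∧ x ∈ U ∧ U ⊆ V ∧ (frontier U).Finite

/-- The ω-limit set of `x` under `f`: all limits of `f^[n i] x` along a strictly
increasing sequence of integers `n`. -/
def omegaSet {X : Type*} [MetricSpace X] (f : X → X) (x : X) : Set X :=
  {y | ∃ n : ℕ → ℕ, StrictMono n ∧ Tendsto (fun i => f^[n i] x) atTop (𝓝 y)}

/-- `M` is a minimal set of `f`: nonempty, closed, strongly invariant, and without
any proper nonempty closed strongly invariant subset. -/
def IsMinimalSet {X : Type*} [MetricSpace X] (f : X → X) (M : Set X) : Prop :=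
  M.Nonempty ∧ IsClosed M ∧ f '' M = M ∧
    ∀ N : Set X, N ⊆ M → N.Nonempty → IsClosed N → f '' N = N → N = M

/-! ### Integer iterates of a homeomorphism -/

lemma zpow_natCast_apply {X : Type*} [TopologicalSpace X] (f : X ≃ₜ X) (n : ℕ) (x : X) :
    (f ^ (n : ℤ)) x = f^[n] x := by
  induction n with
  | zero => rfl
  | succ k ih =>
    rw [Function.iterate_succ_apply', ← ih, Nat.cast_succ, add_comm, zpow_add, zpow_one]
    rfl

lemma zpow_neg_natCast_apply {X : Type*} [TopologicalSpace X] (f : X ≃ₜ X) (n : ℕ) (x : X) :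
    (f ^ (-(n : ℤ))) x = f.symm^[n] x := by
  rw [← zpow_natCast_apply f.symm, zpow_neg, ← inv_zpow]
  rfl

lemma zpow_add_apply {X : Type*} [TopologicalSpace X] (f : X ≃ₜ X) (m n : ℤ) (x : X) :
    (f ^ (m + n)) x = (f ^ m) ((f ^ n) x) := by
  rw [zpow_add]; rfl

lemma zpow_apply_mem {X : Type*} [TopologicalSpace X] {f : X ≃ₜ X} {M : Set X}
    (hM : f ⁻¹' M = M) {x : X} (hx : x ∈ M) (n : ℤ) : (f ^ n) x ∈ M := by
  have hiff : ∀ y, f y ∈ M ↔ y ∈ M := fun y => Set.ext_iff.1 hM y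
  induction n with
  | zero => exact hx
  | succ k ih =>
    rw [add_comm, zpow_add_apply, zpow_one]
    exact (hiff _).2 ih
  | pred k ih =>
    rw [← hiff]
    have := zpow_add_apply f 1 (-(k : ℤ) - 1) x
    rw [zpow_one] at this
    rw [← this]
    convert ih using 3
    ring

/-! ### Neighborhoods with finite boundary -/

lemma exists_isOpen_finite_frontier {X : Type*} [MetricSpace X] (hreg : regularCurveAx X)
    {K V : Set X} (hK : IsCompact K) (hV : IsOpen V) (hKV : K ⊆ V) :
    ∃ U, IsOpen U ∧ K ⊆ U ∧ U ⊆ V ∧ (frontier U).Finite := by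
  refine hK.induction_on (p := fun s => ∃ U, IsOpen U ∧ s ⊆ U ∧ U ⊆ V ∧
    (frontier U).Finite) ?_ ?_ ?_ ?_
  · exact ⟨∅, isOpen_empty, Subset.rfl, empty_subset _, by simp⟩
  · rintro s t hst ⟨U, hU, htU, h⟩
    exact ⟨U, hU, hst.trans htU, h⟩
  · rintro s t ⟨U, hU, hsU, hUV, hUf⟩ ⟨W, hW, htW, hWV, hWf⟩
    refine ⟨U ∪ W, hU.union hW, union_subset_union hsU htW, union_subset hUV hWV, ?_⟩
    exact (hUf.union hWf).subset ((frontier_union_subset U W).trans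
      (union_subset_union inter_subset_left inter_subset_right))
  · intro x hx
    obtain ⟨U, hU, hxU, hUV, hUf⟩ := hreg x V hV (hKV hx)
    exact ⟨U, mem_nhdsWithin_of_mem_nhds (hU.mem_nhds hxU), U, hU, Subset.rfl, hUV, hUf⟩

/-! ### Long stays in a neighborhood of an invariant set -/

lemma exists_right_endpoint_bound {D C : Set ℤ} (h : (D ∩ C).Finite) :
    ∃ R : ℤ, ∀ α β, α ≤ 0 → 0 ≤ β → α ∈ D → β ∈ D → (∀ t, α < t → t < β → t ∈ C) → β ≤ R := by
  obtain ⟨B, hB⟩ := h.bddAbove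
  by_cases hex : ∃ α β, max B 0 < β ∧ α ≤ 0 ∧ β ∈ D ∧ ∀ t, α < t → t < β → t ∈ C
  · obtain ⟨-, β₀, hβ₀, -, hD, -⟩ := hex
    refine ⟨β₀, fun α β hα hβ hαD hβD hC => ?_⟩
    by_contra! hlt
    have h0 := max_lt_iff.1 hβ₀
    exact absurd (hB ⟨hD, hC β₀ (by omega) hlt⟩) (by omega)
  · push Not at hex
    refine ⟨max B 0, fun α β hα hβ hαD hβD hC => ?_⟩
    by_contra! hlt
    obtain ⟨t, h1, h2, h3⟩ := hex α β hlt hα hβD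
    exact h3 (hC t h1 h2)

lemma exists_length_bound {D C : Set ℤ} (h : (D ∩ C).Finite) :
    ∃ R : ℤ, ∀ α β, α ≤ 0 → 0 ≤ β → α ∈ D → β ∈ D → (∀ t, α < t → t < β → t ∈ C) →
      β - α ≤ R := by
  obtain ⟨R₁, h₁⟩ := exists_right_endpoint_bound h
  have h' : ((-D) ∩ (-C)).Finite := by
    rw [← Set.inter_neg]
    exact h.neg
  obtain ⟨R₂, h₂⟩ := exists_right_endpoint_bound h'
  refine ⟨R₁ + R₂, fun α β hα hβ hαD hβD hC => ?_⟩
  have e₁ := h₁ α β hα hβ hαD hβD hC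
  have e₂ := h₂ (-β) (-α) (by omega) (by omega) (by simpa) (by simpa)
    (fun t ht ht' => hC (-t) (by omega) (by omega))
  omega

lemma exists_orbit_gap_bound {X : Type*} [TopologicalSpace X] (f : X ≃ₜ X) {U U₀ : Set X}
    (hU : IsOpen U) (hUf : (frontier U).Finite)
    (hper : ∀ w ∈ closure U₀, ∀ q : ℤ, 0 < q → (f ^ q) w = w → ∀ n : ℤ, (f ^ n) w ∉ frontier U)
    (p : X) :
    ∃ R : ℤ, ∀ α β c : ℤ, α ≤ 0 → 0 ≤ β → (f ^ α) p ∉ U → (f ^ β) p ∉ U →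
      (∀ t, α < t → t < β → (f ^ t) p ∈ closure U) → (f ^ c) p ∈ closure U₀ → β - α ≤ R := by
  by_cases hp : ∃ q : ℤ, 0 < q ∧ (f ^ q) p = p
  · obtain ⟨q, hq, hqp⟩ := hp
    refine ⟨q, fun α β c hα hβ hαU hβU hC hc => ?_⟩
    by_contra! hlt
    have hmem := hC (α + q) (by omega) (by omega)
    rw [zpow_add_apply, hqp] at hmem
    refine hper _ hc q hq ?_ (α - c) ?_
    · rw [← zpow_add_apply, add_comm, zpow_add_apply, hqp]
    · rw [← zpow_add_apply, sub_add_cancel, hU.frontier_eq]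
      exact ⟨hmem, hαU⟩
  · have hinj : Function.Injective fun t : ℤ => (f ^ t) p := by
      have key : ∀ s t : ℤ, (f ^ s) p = (f ^ t) p → ¬ s < t := by
        intro s t hst hlt
        refine hp ⟨t - s, by omega, (f ^ s).injective ?_⟩
        rw [← zpow_add_apply, add_sub_cancel, hst]
      intro s t hst
      exact le_antisymm (not_lt.1 (key t s hst.symm)) (not_lt.1 (key s t hst))
    obtain ⟨R, hR⟩ := exists_length_bound (D := {t : ℤ | (f ^ t) p ∉ U})
      (C := {t : ℤ | (f ^ t) p ∈ closure U}) (by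
        refine (hUf.preimage hinj.injOn).subset fun t ht => ?_
        rw [mem_preimage, hU.frontier_eq]
        exact ⟨ht.2, ht.1⟩)
    exact ⟨R, fun α β c hα hβ hαU hβU hC _ => hR α β hα hβ hαU hβU hC⟩

lemma finite_periodic_orbits {X : Type*} [TopologicalSpace X] (f : X ≃ₜ X) {F : Set X}
    (hF : F.Finite) :
    {w | ∃ q : ℤ, 0 < q ∧ (f ^ q) w = w ∧ ∃ n : ℤ, (f ^ n) w ∈ F}.Finite := by
  have key : ∀ p ∈ F, {w | ∃ q : ℤ, 0 < q ∧ (f ^ q) w = w ∧ ∃ n : ℤ, (f ^ n) w = p}.Finite := by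
    intro p _
    by_cases hp : ∃ q : ℤ, 0 < q ∧ (f ^ q) p = p
    · obtain ⟨q, hq, hqp⟩ := hp
      refine ((Set.finite_Ico (0 : ℤ) q).image fun t => (f ^ t) p).subset ?_
      rintro w ⟨-, -, -, n, rfl⟩
      refine ⟨(-n) % q, ⟨Int.emod_nonneg _ hq.ne', Int.emod_lt_of_pos _ hq⟩, ?_⟩
      have hfix : ∀ k : ℤ, (f ^ (q * k)) ((f ^ n) w) = (f ^ n) w := fun k => by
        have : (f ^ q) ⁻¹' {(f ^ n) w} = {(f ^ n) w} := by
          ext z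
          simp only [mem_preimage, mem_singleton_iff]
          exact ⟨fun hz => (f ^ q).injective (hz.trans hqp.symm), fun hz => hz ▸ hqp⟩
        have h := zpow_apply_mem this (mem_singleton _) k
        rwa [← zpow_mul, mem_singleton_iff] at h
      have h := zpow_add_apply f ((-n) % q) (q * (-n / q)) ((f ^ n) w)
      rw [hfix, Int.emod_add_mul_ediv, ← zpow_add_apply] at h
      simpa using h.symm
    · refine Set.finite_empty.subset ?_
      rintro w ⟨q, hq, hqw, n, rfl⟩
      refine hp ⟨q, hq, ?_⟩
      rw [← zpow_add_apply, add_comm, zpow_add_apply, hqw]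
  refine (hF.biUnion key).subset ?_
  rintro w ⟨q, hq, hqw, n, hn⟩
  exact mem_biUnion hn ⟨q, hq, hqw, n, rfl⟩

/-- An orbit segment which leaves `U` at both ends and visits `U₀` is shadowed, as far as `U` and
`U₀` are concerned, by the orbit of a boundary point of `U` or `U₀`. -/
lemma exists_boundary_shadow {X : Type*} [TopologicalSpace X] [PreconnectedSpace X] (f : X ≃ₜ X)
    {U U₀ : Set X} (hU : IsOpen U) (hU₀ : IsOpen U₀) (hU₀U : U₀ ⊆ U) {z : X} (hz : z ∈ U₀)
    {a b : ℤ} (ha : a < 0) (hb : 0 < b) (hza : (f ^ a) z ∉ U) (hzb : (f ^ b) z ∉ U)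
    (hzU : ∀ t, a < t → t < b → (f ^ t) z ∈ U) :
    ∃ e, ∃ t, a ≤ t ∧ t ≤ b ∧ (f ^ t) e ∈ frontier U ∪ frontier U₀ ∧ (f ^ a) e ∉ U ∧
      (f ^ b) e ∉ U ∧ (∀ s, a < s → s < b → (f ^ s) e ∈ closure U) ∧ e ∈ closure U₀ := by
  classical
  by_cases hfr : ∃ t, a ≤ t ∧ t ≤ b ∧ (f ^ t) z ∈ frontier U
  · obtain ⟨t, hat, htb, ht⟩ := hfr
    exact ⟨z, t, hat, htb, Or.inl ht, hza, hzb, fun s h h' => subset_closure (hzU s h h'),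
      subset_closure hz⟩
  have hext : ∀ t, a ≤ t → t ≤ b → (f ^ t) z ∉ U → (f ^ t) z ∈ (closure U)ᶜ := by
    intro t hat htb ht hcl
    refine hfr ⟨t, hat, htb, ?_⟩
    rw [hU.frontier_eq]
    exact ⟨hcl, ht⟩
  let cell : ℤ → Set X := fun t => if t = 0 then U₀ else if t = a ∨ t = b then (closure U)ᶜ else U
  have hcell0 : cell 0 = U₀ := if_pos rfl
  have hcella : cell a = (closure U)ᶜ := by simp [cell, ha.ne]
  have hcellb : cell b = (closure U)ᶜ := by simp [cell, hb.ne']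
  have hcellmid : ∀ t, a < t → t < b → cell t ⊆ U := by
    intro t h h'
    by_cases ht : t = 0
    · subst ht
      rwa [hcell0]
    · simp [cell, ht, h.ne', h'.ne]
  have hcellopen : ∀ t, IsOpen (cell t) := by
    intro t
    simp only [cell]
    split_ifs
    exacts [hU₀, isClosed_closure.isOpen_compl, hU]
  have hcellfr : ∀ t, frontier (cell t) ⊆ frontier U ∪ frontier U₀ := by
    intro t
    simp only [cell]
    split_ifs
    · exact subset_union_right
    · rw [frontier_compl]
      exact frontier_closure_subset.trans subset_union_left
    · exact subset_union_left
  set O : Set X := ⋂ t ∈ Finset.Icc a b, (f ^ t) ⁻¹' cell t with hO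
  have hOopen : IsOpen O :=
    isOpen_biInter_finset fun t _ => (hcellopen t).preimage (f ^ t).continuous
  have hzO : z ∈ O := by
    simp only [hO, mem_iInter, Finset.mem_Icc, mem_preimage]
    rintro t ⟨h, h'⟩
    simp only [cell]
    split_ifs with h0 h1
    · subst h0
      exact hz
    · rcases h1 with rfl | rfl
      · exact hext _ h h' hza
      · exact hext _ h h' hzb
    · push Not at h1
      exact hzU t (lt_of_le_of_ne h h1.1.symm) (lt_of_le_of_ne h' h1.2)
  have hOne : O ≠ univ := by
    intro h
    have hmem : (f ^ (-a)) z ∈ O := h ▸ mem_univ _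
    simp only [hO, mem_iInter, Finset.mem_Icc, mem_preimage] at hmem
    have h2 := hmem a ⟨le_rfl, by omega⟩
    rw [hcella, ← zpow_add_apply, add_neg_cancel] at h2
    exact h2 (subset_closure (hU₀U hz))
  obtain ⟨e, he⟩ := nonempty_frontier_iff.2 ⟨⟨z, hzO⟩, hOne⟩
  rw [hOopen.frontier_eq] at he
  have hcl : ∀ t, a ≤ t → t ≤ b → (f ^ t) e ∈ closure (cell t) := by
    intro t h h'
    have hsub : O ⊆ (f ^ t) ⁻¹' cell t := biInter_subset_of_mem (Finset.mem_Icc.2 ⟨h, h'⟩)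
    exact (f ^ t).continuous.closure_preimage_subset _ (closure_mono hsub he.1)
  obtain ⟨t, ht, hte⟩ : ∃ t ∈ Finset.Icc a b, (f ^ t) e ∉ cell t := by
    have := he.2
    simp only [hO, mem_iInter, mem_preimage] at this
    push Not at this
    exact this
  rw [Finset.mem_Icc] at ht
  have hout : ∀ y, y ∈ closure ((closure U)ᶜ) → y ∉ U := by
    intro y hy hyU
    rw [closure_compl] at hy
    exact hy (hU.subset_interior_iff.2 subset_closure hyU)
  refine ⟨e, t, ht.1, ht.2, hcellfr t ?_, hout _ (hcella ▸ hcl a le_rfl (by omega)),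
    hout _ (hcellb ▸ hcl b (by omega) le_rfl), fun s h h' =>
    closure_mono (hcellmid s h h') (hcl s h.le h'.le), ?_⟩
  · rw [(hcellopen t).frontier_eq]
    exact ⟨hcl t ht.1 ht.2, hte⟩
  · have := hcl 0 ha.le hb.le
    rwa [hcell0] at this

/-- Near a closed invariant set `M` of a homeomorphism of a regular curve, no orbit both enters and
leaves a given neighborhood of `M`. -/
theorem exists_isOpen_forall_or {X : Type*} [MetricSpace X] [CompactSpace X]
    [ConnectedSpace X] (hreg : regularCurveAx X) (f : X ≃ₜ X) {M V : Set X} (hMc : IsClosed M)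
    (hM : f ⁻¹' M = M) (hV : IsOpen V) (hMV : M ⊆ V) :
    ∃ W, IsOpen W ∧ M ⊆ W ∧
      ∀ z ∈ W, (∀ n : ℕ, f^[n] z ∈ V) ∨ (∀ n : ℕ, f.symm^[n] z ∈ V) := by
  classical
  obtain ⟨U, hU, hMU, hUV, hUf⟩ := exists_isOpen_finite_frontier hreg hMc.isCompact hV hMV
  set P := {w | ∃ q : ℤ, 0 < q ∧ (f ^ q) w = w ∧ ∃ n : ℤ, (f ^ n) w ∈ frontier U} with hP
  have hPf : P.Finite := finite_periodic_orbits f hUf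
  have hMP : M ⊆ Pᶜ := by
    rintro w hw ⟨-, -, -, n, hn⟩
    rw [hU.frontier_eq] at hn
    exact hn.2 (hMU (zpow_apply_mem hM hw n))
  obtain ⟨V₀, hV₀, hMV₀, hV₀cl⟩ := normal_exists_closure_subset hMc hPf.isClosed.isOpen_compl hMP
  obtain ⟨U₀, hU₀, hMU₀, hU₀V, hU₀f⟩ := exists_isOpen_finite_frontier hreg hMc.isCompact
    (hU.inter hV₀) (subset_inter hMU hMV₀)
  have hU₀U : U₀ ⊆ U := hU₀V.trans inter_subset_left
  have hper : ∀ w ∈ closure U₀, ∀ q : ℤ, 0 < q → (f ^ q) w = w →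
      ∀ n : ℤ, (f ^ n) w ∉ frontier U := fun w hw q hq hqw n hn =>
    hV₀cl (closure_mono (hU₀V.trans inter_subset_right) hw) ⟨q, hq, hqw, n, hn⟩
  choose R hR using exists_orbit_gap_bound f hU hUf hper
  obtain ⟨B, hB⟩ := ((hUf.union hU₀f).image R).bddAbove
  set W := U₀ ∩ ⋂ t ∈ Finset.Icc (-B) B, (f ^ t) ⁻¹' U with hW
  refine ⟨W, hU₀.inter (isOpen_biInter_finset fun t _ => hU.preimage (f ^ t).continuous),
    subset_inter hMU₀ (subset_iInter₂ fun t _ x hx => hMU (zpow_apply_mem hM hx t)), ?_⟩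
  intro z hz
  by_contra! hcon
  obtain ⟨⟨n, hn⟩, m, hm⟩ := hcon
  have hex₁ : ∃ n : ℕ, (f ^ (n : ℤ)) z ∉ U :=
    ⟨n, fun h => hn (hUV (by rwa [zpow_natCast_apply] at h))⟩
  have hex₂ : ∃ n : ℕ, (f ^ (-(n : ℤ))) z ∉ U :=
    ⟨m, fun h => hm (hUV (by rwa [zpow_neg_natCast_apply] at h))⟩
  have hzU : z ∈ U := hU₀U hz.1
  have hb := Nat.find_spec hex₁
  have ha := Nat.find_spec hex₂
  have hb' := fun k (hk : k < Nat.find hex₁) => not_not.1 (Nat.find_min hex₁ hk)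
  have ha' := fun k (hk : k < Nat.find hex₂) => not_not.1 (Nat.find_min hex₂ hk)
  generalize Nat.find hex₁ = b at hb hb'
  generalize Nat.find hex₂ = a at ha ha'
  have hb0 : 0 < b := Nat.pos_of_ne_zero fun h => hb (by subst h; exact hzU)
  have ha0 : 0 < a := Nat.pos_of_ne_zero fun h => ha (by subst h; exact hzU)
  have hbB : B < b := by
    by_contra! h
    exact hb (mem_iInter₂.1 hz.2 (b : ℤ) (Finset.mem_Icc.2 ⟨by omega, h⟩))
  obtain ⟨e, t, hat, htb, hp, hea, heb, heU, he₀⟩ := exists_boundary_shadow f hU hU₀ hU₀U hz.1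
    (a := -(a : ℤ)) (b := b) (by omega) (by omega) ha hb (by
      intro t h h'
      rcases le_total 0 t with h0 | h0
      · lift t to ℕ using h0
        exact hb' t (by omega)
      · obtain ⟨k, rfl⟩ : ∃ k : ℕ, t = -(k : ℤ) := ⟨t.natAbs, by omega⟩
        exact ha' k (by omega))
  have hshift : ∀ s : ℤ, (f ^ (s - t)) ((f ^ t) e) = (f ^ s) e := fun s => by
    rw [← zpow_add_apply, sub_add_cancel]
  have hlen := hR ((f ^ t) e) (-(a : ℤ) - t) (b - t) (0 - t) (by omega) (by omega)
    (by rwa [hshift]) (by rwa [hshift])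
    (fun s h h' => by
      have := heU (s + t) (by omega) (by omega)
      rwa [← hshift, add_sub_cancel_right] at this)
    (by rw [hshift]; exact he₀)
  have := hB (mem_image_of_mem R hp)
  omega

/-! ### Limit sets -/

lemma mem_omegaSet_iff {X : Type*} [MetricSpace X] {f : X → X} {x y : X} :
    y ∈ omegaSet f x ↔ MapClusterPt y atTop fun n => f^[n] x := by
  constructor
  · rintro ⟨n, hn, h⟩
    exact h.mapClusterPt.of_comp hn.tendsto_atTop
  · exact fun h => h.tendsto_subseq

lemma exists_iterate_mem_of_mem_omegaSet {X : Type*} [MetricSpace X] {f : X → X} {x y : X}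
    (hy : y ∈ omegaSet f x) {U : Set X} (hU : IsOpen U) (hyU : y ∈ U) (N : ℕ) :
    ∃ n, N < n ∧ f^[n] x ∈ U :=
  frequently_atTop'.1 ((mem_omegaSet_iff.1 hy).frequently (hU.mem_nhds hyU)) N

lemma isClosed_omegaSet {X : Type*} [MetricSpace X] (f : X → X) (x : X) :
    IsClosed (omegaSet f x) := by
  have : omegaSet f x = {y | ClusterPt y (map (fun n => f^[n] x) atTop)} :=
    Set.ext fun _ => mem_omegaSet_iff
  rw [this]
  exact isClosed_setOfPred_clusterPt

lemma omegaSet_nonempty {X : Type*} [MetricSpace X] [CompactSpace X] (f : X → X) (x : X) :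
    (omegaSet f x).Nonempty := by
  obtain ⟨y, -, φ, hφ, h⟩ := isCompact_univ.tendsto_subseq (x := fun n => f^[n] x)
    fun _ => mem_univ _
  exact ⟨y, φ, hφ, h⟩

lemma apply_mem_omegaSet {X : Type*} [MetricSpace X] {f : X → X} (hf : Continuous f) {x y : X}
    (hy : y ∈ omegaSet f x) : f y ∈ omegaSet f x := by
  obtain ⟨n, hn, h⟩ := hy
  refine ⟨fun i => n i + 1, fun i j hij => Nat.succ_lt_succ (hn hij), ?_⟩
  exact ((hf.tendsto y).comp h).congr fun i => (Function.iterate_succ_apply' f (n i) x).symm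

lemma symm_apply_mem_omegaSet {X : Type*} [MetricSpace X] {f : X ≃ₜ X} {x y : X}
    (hy : y ∈ omegaSet f x) : f.symm y ∈ omegaSet f x := by
  obtain ⟨n, hn, h⟩ := hy
  refine ⟨fun i => n (i + 1) - 1, fun i j hij => ?_, ?_⟩
  · have : n (i + 1) < n (j + 1) := hn (Nat.succ_lt_succ hij)
    have := hn.id_le (i + 1)
    simp only [id] at this
    show n (i + 1) - 1 < n (j + 1) - 1
    omega
  · refine ((f.symm.continuous.tendsto y).comp (h.comp (tendsto_add_atTop_nat 1))).congr fun i => ?_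
    have := hn.id_le (i + 1)
    simp only [id] at this
    obtain ⟨k, hk⟩ : ∃ k, n (i + 1) = k + 1 := ⟨n (i + 1) - 1, by omega⟩
    simp [hk, Function.iterate_succ_apply']

lemma preimage_omegaSet {X : Type*} [MetricSpace X] (f : X ≃ₜ X) (x : X) :
    f ⁻¹' omegaSet f x = omegaSet f x := by
  ext y
  exact ⟨fun h => by simpa using symm_apply_mem_omegaSet h,
    fun h => apply_mem_omegaSet f.continuous h⟩

lemma preimage_eq_of_symm_preimage_eq {X : Type*} [TopologicalSpace X] {f : X ≃ₜ X} {M : Set X}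
    (h : f.symm ⁻¹' M = M) : f ⁻¹' M = M := by
  conv_lhs => rw [← h]
  rw [← preimage_comp]
  simp

lemma omegaSet_subset_of_forall_iterate_mem {X : Type*} [MetricSpace X] {f : X → X} {x : X}
    {M : Set X} (hM : IsClosed M) (h : ∀ n, f^[n] x ∈ M) : omegaSet f x ⊆ M := by
  rintro y ⟨n, -, hn⟩
  exact hM.mem_of_tendsto hn (Eventually.of_forall fun i => h (n i))

lemma iterate_mem_of_preimage_eq {X : Type*} {f : X → X} {M : Set X} (hM : f ⁻¹' M = M) {x : X}
    (hx : x ∈ M) (n : ℕ) : f^[n] x ∈ M := by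
  induction n with
  | zero => exact hx
  | succ k ih =>
    rw [Function.iterate_succ_apply']
    rw [← hM] at ih
    exact ih

lemma omegaSet_iterate_subset {X : Type*} [MetricSpace X] (f : X → X) (x : X) (k : ℕ) :
    omegaSet f (f^[k] x) ⊆ omegaSet f x := by
  rintro y ⟨n, hn, h⟩
  refine ⟨fun i => n i + k, fun i j hij => Nat.add_lt_add_right (hn hij) k, ?_⟩
  simpa only [Function.iterate_add_apply] using h

lemma omegaSet_iterate {X : Type*} [MetricSpace X] (f : X → X) (x : X) (k : ℕ) :
    omegaSet f (f^[k] x) = omegaSet f x := by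
  refine (omegaSet_iterate_subset f x k).antisymm ?_
  rintro y ⟨n, hn, h⟩
  have hk : ∀ i, k ≤ n (i + k) := fun i => (Nat.le_add_left k i).trans (hn.id_le _)
  refine ⟨fun i => n (i + k) - k, fun i j hij => ?_, ?_⟩
  · have := hn (Nat.add_lt_add_right hij k)
    have := hk i
    show n (i + k) - k < n (j + k) - k
    omega
  · refine (h.comp (tendsto_add_atTop_nat k)).congr fun i => ?_
    rw [← Function.iterate_add_apply, Nat.sub_add_cancel (hk i)]
    rfl

lemma omegaSet_symm_iterate {X : Type*} [MetricSpace X] (f : X ≃ₜ X) (x : X) (k : ℕ) :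
    omegaSet f (f.symm^[k] x) = omegaSet f x := by
  rw [← omegaSet_iterate f _ k, Function.RightInverse.iterate f.apply_symm_apply k]

/-- The ω-limit sets of a homeomorphism of a regular curve are minimal. -/
theorem omegaSet_subset_of_preimage_eq {X : Type*} [MetricSpace X] [CompactSpace X]
    [ConnectedSpace X] (hreg : regularCurveAx X) (f : X ≃ₜ X) {x : X} {M : Set X}
    (hMc : IsClosed M) (hM : f ⁻¹' M = M) (hMne : M.Nonempty) (hMx : M ⊆ omegaSet f x) :
    omegaSet f x ⊆ M := by
  intro y hy
  by_contra hyM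
  obtain ⟨V, hV, hMV, hVcl⟩ := normal_exists_closure_subset hMc isOpen_compl_singleton
    (subset_compl_singleton_iff.2 hyM)
  obtain ⟨W, hW, hMW, h⟩ := exists_isOpen_forall_or hreg f hMc hM hV hMV
  have hyV : y ∈ (closure V)ᶜ := fun h => hVcl h rfl
  have hclo : IsOpen (closure V)ᶜ := isClosed_closure.isOpen_compl
  obtain ⟨w, hw⟩ := hMne
  obtain ⟨n₀, -, h₀⟩ := exists_iterate_mem_of_mem_omegaSet hy hclo hyV 0
  obtain ⟨n₁, h₀₁, h₁⟩ := exists_iterate_mem_of_mem_omegaSet (hMx hw) hW (hMW hw) n₀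
  obtain ⟨n₂, h₁₂, h₂⟩ := exists_iterate_mem_of_mem_omegaSet hy hclo hyV n₁
  rcases h _ h₁ with h | h
  · have := h (n₂ - n₁)
    rw [← Function.iterate_add_apply, Nat.sub_add_cancel h₁₂.le] at this
    exact h₂ (subset_closure this)
  · have := h (n₁ - n₀)
    rw [← Nat.sub_add_cancel h₀₁.le, Function.iterate_add_apply, Nat.add_sub_cancel,
      Function.LeftInverse.iterate f.symm_apply_apply] at this
    exact h₀ (subset_closure this)

/-! ### Continuity of the limit set maps -/

lemma omegaSet_eq_of_continuous {X : Type*} [MetricSpace X] [CompactSpace X]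
    [ConnectedSpace X] (hreg : regularCurveAx X) (f : X ≃ₜ X)
    (hcont : ∀ x : X, ∀ ε > 0, ∃ δ > 0, ∀ y : X, dist y x < δ →
      hausdorffDist (omegaSet f y) (omegaSet f x) < ε) (x : X) :
    omegaSet f x = omegaSet f.symm x := by
  obtain ⟨z, hz⟩ := omegaSet_nonempty f.symm x
  have hinv : f ⁻¹' omegaSet f.symm x = omegaSet f.symm x :=
    preimage_eq_of_symm_preimage_eq (preimage_omegaSet f.symm x)
  have hsub : omegaSet f z ⊆ omegaSet f.symm x :=
    omegaSet_subset_of_forall_iterate_mem (isClosed_omegaSet _ _) fun n =>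
      iterate_mem_of_preimage_eq hinv hz n
  have hzx : omegaSet f z = omegaSet f.symm x :=
    hsub.antisymm <| omegaSet_subset_of_preimage_eq hreg f.symm (isClosed_omegaSet _ _)
      (preimage_eq_of_symm_preimage_eq (f := f.symm) (preimage_omegaSet f z))
      (omegaSet_nonempty _ _) hsub
  have hdist : hausdorffDist (omegaSet f x) (omegaSet f z) = 0 := by
    refine le_antisymm (le_of_forall_pos_lt_add fun ε hε => ?_) hausdorffDist_nonneg
    obtain ⟨δ, hδ, h⟩ := hcont z ε hε
    obtain ⟨n, -, hn⟩ := exists_iterate_mem_of_mem_omegaSet hz isOpen_ball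
      (mem_ball_self hδ) 0
    simpa [omegaSet_symm_iterate] using h _ hn
  rw [← hzx]
  refine ((isClosed_omegaSet f x).hausdorffDist_zero_iff_eq (isClosed_omegaSet f z) ?_).1 hdist
  exact hausdorffEDist_ne_top_of_nonempty_of_bounded (omegaSet_nonempty _ _)
    (omegaSet_nonempty _ _) isBounded_of_compactSpace isBounded_of_compactSpace

/-- If every forward orbit from `M` is dense in `M`, then orbits starting near `M` are
`ε`-dense in `M`. -/
lemma exists_isOpen_forall_exists_iterate_near {X : Type*} [MetricSpace X] {f : X → X}
    (hf : Continuous f) {M : Set X} (hMc : IsCompact M) (hM : ∀ z ∈ M, M ⊆ omegaSet f z)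
    {ε : ℝ} (hε : 0 < ε) :
    ∃ W, IsOpen W ∧ M ⊆ W ∧ ∀ z ∈ W, ∀ m ∈ M, ∃ n, dist m (f^[n] z) < ε := by
  obtain ⟨t, htM, htf, ht⟩ := hMc.finite_cover_balls (half_pos hε)
  refine ⟨⋂ c ∈ t, ⋃ n : ℕ, f^[n] ⁻¹' ball c (ε / 2), htf.isOpen_biInter fun c _ =>
    isOpen_iUnion fun n => isOpen_ball.preimage (hf.iterate n), ?_, ?_⟩
  · intro z hz
    simp only [mem_iInter, mem_iUnion]
    intro c hc
    obtain ⟨n, -, hn⟩ := exists_iterate_mem_of_mem_omegaSet (hM z hz (htM hc)) isOpen_ball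
      (mem_ball_self (half_pos hε)) 0
    exact ⟨n, hn⟩
  · intro z hz m hm
    obtain ⟨c, hc, hmc⟩ := mem_iUnion₂.1 (ht hm)
    obtain ⟨n, hn⟩ := mem_iUnion.1 (mem_iInter₂.1 hz c hc)
    refine ⟨n, ?_⟩
    have h1 : dist m c < ε / 2 := hmc
    have h2 : dist (f^[n] z) c < ε / 2 := hn
    linarith [dist_triangle_right m (f^[n] z) c]

lemma continuous_of_omegaSet_eq {X : Type*} [MetricSpace X] [CompactSpace X]
    [ConnectedSpace X] (hreg : regularCurveAx X) (f : X ≃ₜ X)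
    (heq : ∀ x : X, omegaSet f x = omegaSet f.symm x) (x : X) {ε : ℝ} (hε : 0 < ε) :
    ∃ δ > 0, ∀ y : X, dist y x < δ → hausdorffDist (omegaSet f y) (omegaSet f x) < ε := by
  have hMc := isClosed_omegaSet f x
  have hinv := preimage_omegaSet f x
  have hmin : ∀ z ∈ omegaSet f x, omegaSet f x ⊆ omegaSet f z := fun z hz =>
    omegaSet_subset_of_preimage_eq hreg f (isClosed_omegaSet f z) (preimage_omegaSet f z)
      (omegaSet_nonempty _ _) (omegaSet_subset_of_forall_iterate_mem hMc fun n =>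
        iterate_mem_of_preimage_eq hinv hz n)
  obtain ⟨W₀, hW₀, hMW₀, hdense⟩ := exists_isOpen_forall_exists_iterate_near f.continuous
    hMc.isCompact hmin (half_pos hε)
  obtain ⟨V, hV, hMV, hVcl⟩ := normal_exists_closure_subset hMc
    (hW₀.inter (isOpen_thickening (δ := ε / 2) (E := omegaSet f x)))
    (subset_inter hMW₀ (self_subset_thickening (half_pos hε) _))
  obtain ⟨W, hW, hMW, h⟩ := exists_isOpen_forall_or hreg f hMc hinv hV hMV
  obtain ⟨m, hm⟩ := omegaSet_nonempty f x
  obtain ⟨n, -, hn⟩ := exists_iterate_mem_of_mem_omegaSet hm hW (hMW hm) 0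
  obtain ⟨δ, hδ, hball⟩ := Metric.isOpen_iff.1 (hW.preimage (f.continuous.iterate n)) x hn
  refine ⟨δ, hδ, fun y hy => ?_⟩
  have hsub : omegaSet f y ⊆ closure V := by
    rw [← omegaSet_iterate f y n]
    rcases h _ (hball hy) with h | h
    · exact omegaSet_subset_of_forall_iterate_mem isClosed_closure fun k => subset_closure (h k)
    · rw [heq]
      exact omegaSet_subset_of_forall_iterate_mem isClosed_closure fun k => subset_closure (h k)
  refine (hausdorffDist_le_of_mem_dist (half_pos hε).le ?_ ?_).trans_lt (half_lt_self hε)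
  · intro z hz
    obtain ⟨w, hw, hd⟩ := mem_thickening_iff.1 (hVcl (hsub hz)).2
    exact ⟨w, hw, hd.le⟩
  · intro w hw
    obtain ⟨z, hz⟩ := omegaSet_nonempty f y
    obtain ⟨k, hk⟩ := hdense z (hVcl (hsub hz)).1 w hw
    exact ⟨_, iterate_mem_of_preimage_eq (preimage_omegaSet f y) hz k, hk.le⟩

/-- For a homeomorphism of a regular curve, the following are equivalent:
(1) x ↦ ω_f(x) is continuous; (2) ω_f(x) = α_f(x) for all x; (3) x ↦ α_f(x) is
continuous. (Here α_f(x) = ω_{f⁻¹}(x), and continuity is with respect to the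
Hausdorff metric.) -/
theorem omegaMap_continuous_iff {X : Type*} [MetricSpace X] [Nonempty X]
    [CompactSpace X] [ConnectedSpace X] (hreg : regularCurveAx X) (f : X ≃ₜ X) :
    ((∀ x : X, ∀ ε > 0, ∃ δ > 0, ∀ y : X, dist y x < δ →
        hausdorffDist (omegaSet (⇑f) y) (omegaSet (⇑f) x) < ε) ↔
      (∀ x : X, omegaSet (⇑f) x = omegaSet (⇑f.symm) x)) ∧
    ((∀ x : X, omegaSet (⇑f) x = omegaSet (⇑f.symm) x) ↔
      (∀ x : X, ∀ ε > 0, ∃ δ > 0, ∀ y : X, dist y x < δ →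
        hausdorffDist (omegaSet (⇑f.symm) y) (omegaSet (⇑f.symm) x) < ε)) := by
  have hsymm : (∀ x : X, omegaSet f.symm x = omegaSet f.symm.symm x) ↔
      ∀ x : X, omegaSet f x = omegaSet f.symm x := forall_congr' fun x => eq_comm
  refine ⟨⟨omegaSet_eq_of_continuous hreg f, fun h x ε hε =>
    continuous_of_omegaSet_eq hreg f h x hε⟩, ⟨fun h x ε hε =>
    continuous_of_omegaSet_eq hreg f.symm (hsymm.2 h) x hε, fun h =>
    hsymm.1 (omegaSet_eq_of_continuous hreg f.symm h)⟩⟩
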